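/- arXiv:2006.08953 — 2 statements merged into one kernel-verified Lean document; each statement's English description precedes it below -/
import Mathlib

section
/- Assume the ETR premise. Then for every x ∈ X and every n ∈ ℕ, there do not exist x-approximations f and g with φ₀(n,x,f) and ψ₀(n,x,g). -/
/-- `H_φ(X↾x, Y)` restriction operation: `Y^x = {(x',n) ∈ Y | x' < x}`. -/
def restrictS {X : Type*} [LinearOrder X] (Z : Set (X × ℕ)) (x : X) : Set (X × ℕ) :=
  {p ∈ Z | p.1 < x}

/-- `H_φ(X, Y)`: for all `x ∈ X` and `n ∈ ℕ`, `(x,n) ∈ Y ↔ φ(n, x, Y^x)`. -/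
def Hfull {X : Type*} [LinearOrder X]
    (φ : ℕ → X → Set (X × ℕ) → Prop) (Y : Set (X × ℕ)) : Prop :=
  ∀ (x : X) (n : ℕ), (x, n) ∈ Y ↔ φ n x (restrictS Y x)

/-- `H_φ(X↾x, Z)`: `Z ⊆ {(x',n) | x' < x}` and for all `x' < x` and `n`,
`(x',n) ∈ Z ↔ φ(n, x', Z^{x'})`. -/
def Hres {X : Type*} [LinearOrder X]
    (φ : ℕ → X → Set (X × ℕ) → Prop) (x : X) (Z : Set (X × ℕ)) : Prop :=
  (∀ p ∈ Z, p.1 < x) ∧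
  ∀ (x' : X) (n : ℕ), x' < x → ((x', n) ∈ Z ↔ φ n x' (restrictS Z x'))

/-- A partial function `X × ℕ → Option Bool` is finite if its support is finite. -/
def FinSupp {X : Type*} (f : X × ℕ → Option Bool) : Prop :=
  {p | f p ≠ none}.Finite

/-- `f ⪯ g`: every defined value of `f` is a defined value of `g` with the same value. -/
def PLE {X : Type*} (f g : X × ℕ → Option Bool) : Prop :=
  ∀ p b, f p = some b → g p = some b

/-- `f ⪯ Z` for a set `Z ⊆ X × ℕ` (identified with its characteristic function). -/
def PLESet {X : Type*} (f : X × ℕ → Option Bool) (Z : Set (X × ℕ)) : Prop :=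
  ∀ p : X × ℕ, (f p = some true → p ∈ Z) ∧ (f p = some false → p ∉ Z)

/-- `f↾x`: restriction of `f` to arguments `(x',n)` with `x' < x`. -/
def restrictF {X : Type*} [LinearOrder X] (f : X × ℕ → Option Bool) (x : X) :
    X × ℕ → Option Bool :=
  fun p => if p.1 < x then f p else none

/-- `g` is an `x`-extension of `f`: `f ⪯ g` and whenever `g(x',n)` is defined but
`f(x',n)` is not, we have `x ≤ x'` and `g(x',n) = false`. -/
def IsExtension {X : Type*} [LinearOrder X] (x : X) (f g : X × ℕ → Option Bool) : Prop :=
  PLE f g ∧ ∀ p : X × ℕ, g p ≠ none → f p = none → x ≤ p.1 ∧ g p = some false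

/-- `f` is an `x`-approximation (relative to `φ₀` and `ψ₀`). -/
def IsApprox {X : Type*} [LinearOrder X]
    (φ₀ ψ₀ : ℕ → X → (X × ℕ → Option Bool) → Prop) (x : X)
    (f : X × ℕ → Option Bool) : Prop :=
  FinSupp f ∧
  (∀ (x' : X) (n : ℕ) (b : Bool), f (x', n) = some b → x ≤ x' → b = false) ∧
  (∀ (x' : X) (n : ℕ), x' < x → f (x', n) = some true →
    ∃ h, FinSupp h ∧ IsExtension x' (restrictF f x') h ∧ φ₀ n x' h) ∧
  (∀ (x' : X) (n : ℕ), x' < x → f (x', n) = some false →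
    ∃ h, FinSupp h ∧ IsExtension x' (restrictF f x') h ∧ ψ₀ n x' h)

/-- `φ(n,x,Z)`: there is a finite partial function `f ⪯ Z` with `φ₀(n,x,f)`. -/
def phi {X : Type*} (φ₀ : ℕ → X → (X × ℕ → Option Bool) → Prop)
    (n : ℕ) (x : X) (Z : Set (X × ℕ)) : Prop :=
  ∃ f, FinSupp f ∧ PLESet f Z ∧ φ₀ n x f

/-- The premise of effective transfinite recursion. -/
def ETRPremise {X : Type*} [LinearOrder X]
    (φ₀ ψ₀ : ℕ → X → (X × ℕ → Option Bool) → Prop) : Prop :=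
  ∀ (x : X) (Z : Set (X × ℕ)), Hres (phi φ₀) x Z →
    ∀ n : ℕ, (phi φ₀ n x Z ↔ ¬ phi ψ₀ n x Z)

theorem exists_hfull {X : Type*} [LinearOrder X]
    (hwf : WellFounded ((· < ·) : X → X → Prop)) (φ : ℕ → X → Set (X × ℕ) → Prop) :
    ∃ Z, Hfull φ Z := by
  let F : ∀ x : X, (∀ y : X, y < x → Set ℕ) → Set ℕ :=
    fun x S => {n | φ n x {p | ∃ h : p.1 < x, p.2 ∈ S p.1 h}}
  refine ⟨{p | p.2 ∈ hwf.fix F p.1}, fun x n => ?_⟩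
  have hset : {p : X × ℕ | ∃ _ : p.1 < x, p.2 ∈ hwf.fix F p.1} =
      restrictS {p | p.2 ∈ hwf.fix F p.1} x := by
    ext p
    simp [restrictS, and_comm]
  rw [← hset]
  change n ∈ hwf.fix F x ↔ _
  rw [hwf.fix_eq]
  rfl

theorem restrictS_restrictS_of_lt {X : Type*} [LinearOrder X] (Z : Set (X × ℕ)) {x x' : X}
    (hx : x' < x) : restrictS (restrictS Z x) x' = restrictS Z x' := by
  ext p
  simp only [restrictS, Set.mem_ofPred_eq]
  exact ⟨fun h => ⟨h.1.1, h.2⟩, fun h => ⟨⟨h.1, h.2.trans hx⟩, h.2⟩⟩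

theorem Hfull.hres_restrictS {X : Type*} [LinearOrder X] {φ : ℕ → X → Set (X × ℕ) → Prop}
    {Z : Set (X × ℕ)} (hZ : Hfull φ Z) (x : X) : Hres φ x (restrictS Z x) := by
  refine ⟨fun p hp => hp.2, fun x' n hx => ?_⟩
  rw [restrictS_restrictS_of_lt Z hx, ← hZ x' n]
  exact ⟨fun h => h.1, fun h => ⟨h, hx⟩⟩

theorem PLESet.of_isExtension {X : Type*} [LinearOrder X] {x : X} {f h : X × ℕ → Option Bool}
    {Z : Set (X × ℕ)} (hf : PLESet (restrictF f x) Z) (hh : IsExtension x (restrictF f x) h) :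
    PLESet h (restrictS Z x) := by
  intro p
  cases hp : restrictF f x p with
  | some b =>
    have hpx : p.1 < x := by
      by_contra hpx
      simp [restrictF, hpx] at hp
    rw [hh.1 p b hp, ← hp]
    exact ⟨fun ht => ⟨(hf p).1 ht, hpx⟩, fun hF hm => (hf p).2 hF hm.1⟩
  | none =>
    refine ⟨fun ht => ?_, fun hF hm => ?_⟩
    · have := (hh.2 p (by simp [ht]) hp).2
      simp [ht] at this
    · exact absurd hm.2 (not_lt.mpr (hh.2 p (by simp [hF]) hp).1)

theorem IsApprox.isExtension_restrictF {X : Type*} [LinearOrder X]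
    {φ₀ ψ₀ : ℕ → X → (X × ℕ → Option Bool) → Prop} {x : X} {f : X × ℕ → Option Bool}
    (hf : IsApprox φ₀ ψ₀ x f) : IsExtension x (restrictF f x) f := by
  refine ⟨fun p b hp => ?_, fun p hp hr => ?_⟩
  · simp only [restrictF] at hp
    split_ifs at hp
    exact hp
  · have hx : x ≤ p.1 := by
      by_contra hx
      simp only [restrictF, if_pos (not_le.mp hx)] at hr
      exact hp hr
    obtain ⟨b, hb⟩ := Option.ne_none_iff_exists'.mp hp
    exact ⟨hx, hf.2.1 p.1 p.2 b hb hx ▸ hb⟩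

theorem IsApprox.pleSet_restrictF {X : Type*} [LinearOrder X]
    (hwf : WellFounded ((· < ·) : X → X → Prop))
    {φ₀ ψ₀ : ℕ → X → (X × ℕ → Option Bool) → Prop} (hprem : ETRPremise φ₀ ψ₀)
    {Z : Set (X × ℕ)} (hZ : Hfull (phi φ₀) Z) {x : X} {f : X × ℕ → Option Bool}
    (hf : IsApprox φ₀ ψ₀ x f) : ∀ y ≤ x, PLESet (restrictF f y) Z := by
  intro y
  induction y using hwf.induction with
  | _ y ih =>
    rintro hyx ⟨x', n⟩
    by_cases hlt : x' < y
    · have hx : x' < x := hlt.trans_le hyx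
      simp only [restrictF, if_pos hlt]
      refine ⟨fun ht => ?_, fun hF hm => ?_⟩
      · obtain ⟨h, hfin, hext, hφ⟩ := hf.2.2.1 x' n hx ht
        exact (hZ x' n).2 ⟨h, hfin, (ih x' hlt hx.le).of_isExtension hext, hφ⟩
      · obtain ⟨h, hfin, hext, hψ⟩ := hf.2.2.2 x' n hx hF
        exact (hprem x' _ (hZ.hres_restrictS x') n).1 ((hZ x' n).1 hm)
          ⟨h, hfin, (ih x' hlt hx.le).of_isExtension hext, hψ⟩
    · simp [restrictF, hlt]

/-- under the ETR premise, no `x`-approximations `f` and `g` can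
satisfy `φ₀(n,x,f)` and `ψ₀(n,x,g)` simultaneously. -/
theorem stmt_4 {X : Type*} [LinearOrder X]
    (hwf : WellFounded ((· < ·) : X → X → Prop))
    (φ₀ ψ₀ : ℕ → X → (X × ℕ → Option Bool) → Prop)
    (hφmono : ∀ (n : ℕ) (x : X) (f g : X × ℕ → Option Bool),
      FinSupp f → FinSupp g → φ₀ n x f → PLE f g → φ₀ n x g)
    (hψmono : ∀ (n : ℕ) (x : X) (f g : X × ℕ → Option Bool),
      FinSupp f → FinSupp g → ψ₀ n x f → PLE f g → ψ₀ n x g)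
    (hprem : ETRPremise φ₀ ψ₀) :
    ∀ (x : X) (n : ℕ),
      ¬ ∃ f g : X × ℕ → Option Bool,
        IsApprox φ₀ ψ₀ x f ∧ IsApprox φ₀ ψ₀ x g ∧ φ₀ n x f ∧ ψ₀ n x g := by
  rintro x n ⟨f, g, hf, hg, hφ, hψ⟩
  obtain ⟨Z, hZ⟩ := exists_hfull hwf (phi φ₀)
  have key : ∀ {k}, IsApprox φ₀ ψ₀ x k → PLESet k (restrictS Z x) := fun hk =>
    (hk.pleSet_restrictF hwf hprem hZ x le_rfl).of_isExtension hk.isExtension_restrictF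
  exact (hprem x _ (hZ.hres_restrictS x) n).1 ⟨f, hf.1, key hf, hφ⟩ ⟨g, hg.1, key hg, hψ⟩
end

section
/- Assume the ETR premise. Then the two sets {(x,n) ∈ X × ℕ | φ₀(n,x,f) for some x-approximation f} and {(x,n) ∈ X × ℕ | ψ₀(n,x,g) for no x-approximation g} are equal. -/
theorem exists_finite_closed_superset {α : Type*} {r : α → α → Prop} (hr : WellFounded r)
    {S : α → Set α} (hS : ∀ a, (S a).Finite) (hlt : ∀ a, ∀ b ∈ S a, r b a)
    {F : Set α} (hF : F.Finite) :
    ∃ D : Set α, D.Finite ∧ F ⊆ D ∧ ∀ a ∈ D, S a ⊆ D := by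
  have key : ∀ a, ∃ D : Set α, D.Finite ∧ a ∈ D ∧ ∀ b ∈ D, S b ⊆ D := by
    intro a
    induction a using hr.induction with
    | _ a ih =>
      choose C hfin hmem hcl using ih
      refine ⟨insert a (⋃ b : S a, C b.1 (hlt a b b.2)), ?_, Set.mem_insert _ _, ?_⟩
      · have := (hS a).to_subtype
        exact (Set.finite_iUnion fun b : S a => hfin b (hlt a b b.2)).insert a
      · rintro b (rfl | hb) c hc
        · exact Or.inr (Set.mem_iUnion.2 ⟨⟨c, hc⟩, hmem c _⟩)
        · obtain ⟨d, hd⟩ := Set.mem_iUnion.1 hb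
          exact Or.inr (Set.mem_iUnion.2 ⟨d, hcl _ _ b hd hc⟩)
  choose C hfin hmem hcl using key
  refine ⟨⋃ a ∈ F, C a, hF.biUnion fun a _ => hfin a,
    fun a ha => Set.mem_biUnion ha (hmem a), fun a ha b hb => ?_⟩
  obtain ⟨c, hc, hac⟩ := Set.mem_iUnion₂.1 ha
  exact Set.mem_biUnion hc (hcl c a hac hb)

theorem exists_Hfull {X : Type*} [LinearOrder X]
    (hwf : WellFounded ((· < ·) : X → X → Prop)) (φ : ℕ → X → Set (X × ℕ) → Prop) :
    ∃ Y, Hfull φ Y := by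
  let T : X → Set ℕ := hwf.fix fun x rec => {n | φ n x {p | ∃ h : p.1 < x, p.2 ∈ rec p.1 h}}
  have hT : ∀ x, T x = {n | φ n x {p | ∃ _ : p.1 < x, p.2 ∈ T p.1}} := fun x => hwf.fix_eq _ x
  refine ⟨{p | p.2 ∈ T p.1}, fun x n => ?_⟩
  have hres : restrictS {p | p.2 ∈ T p.1} x = {p | ∃ _ : p.1 < x, p.2 ∈ T p.1} := by
    ext p
    simp [restrictS, and_comm]
  rw [hres, Set.mem_ofPred_eq, hT x, Set.mem_ofPred_eq]

theorem Hfull.hres {X : Type*} [LinearOrder X] {φ : ℕ → X → Set (X × ℕ) → Prop}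
    {Y : Set (X × ℕ)} (hY : Hfull φ Y) (x : X) : Hres φ x (restrictS Y x) := by
  refine ⟨fun p hp => hp.2, fun x' n hx => ?_⟩
  have hres : restrictS (restrictS Y x) x' = restrictS Y x' := by
    ext p
    exact ⟨fun h => ⟨h.1.1, h.2⟩, fun h => ⟨⟨h.1, h.2.trans hx⟩, h.2⟩⟩
  rw [hres, ← hY]
  exact ⟨fun h => h.1, fun h => ⟨h, hx⟩⟩

theorem IsExtension.pleSet_restrictS {X : Type*} [LinearOrder X] {x : X}
    {f h : X × ℕ → Option Bool} {Y : Set (X × ℕ)} (hext : IsExtension x f h)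
    (hf : PLESet f (restrictS Y x)) : PLESet h (restrictS Y x) := by
  intro p
  rcases hfp : f p with _ | b
  · by_cases hp : h p = none
    · simp [hp]
    · obtain ⟨hx, hfalse⟩ := hext.2 p hp hfp
      exact ⟨fun h => by simp [h] at hfalse, fun _ hmem => hmem.2.not_ge hx⟩
  · rw [hext.1 p b hfp, ← hfp]
    exact hf p

/-- The characteristic function of `Z`, restricted to the arguments in `D`. -/
noncomputable def partialChar {X : Type*} (D Z : Set (X × ℕ)) : X × ℕ → Option Bool :=
  open Classical in fun p => if p ∈ D then some (decide (p ∈ Z)) else none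

@[simp]
theorem partialChar_eq_true {X : Type*} {D Z : Set (X × ℕ)} {p : X × ℕ} :
    partialChar D Z p = some true ↔ p ∈ D ∧ p ∈ Z := by
  simp [partialChar]

@[simp]
theorem partialChar_eq_false {X : Type*} {D Z : Set (X × ℕ)} {p : X × ℕ} :
    partialChar D Z p = some false ↔ p ∈ D ∧ p ∉ Z := by
  simp [partialChar]

theorem partialChar_ne_none {X : Type*} {D Z : Set (X × ℕ)} {p : X × ℕ} :
    partialChar D Z p ≠ none ↔ p ∈ D := by
  simp [partialChar]

theorem finSupp_partialChar {X : Type*} {D : Set (X × ℕ)} (hD : D.Finite) (Z : Set (X × ℕ)) :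
    FinSupp (partialChar D Z) := by
  simpa only [FinSupp, partialChar_ne_none, Set.ofPred_mem_eq]

theorem PLESet.ple_partialChar {X : Type*} {f : X × ℕ → Option Bool} {D Z : Set (X × ℕ)}
    (hf : PLESet f Z) (hD : ∀ p, f p ≠ none → p ∈ D) : PLE f (partialChar D Z) := by
  intro p b hb
  have hp := hD p (by simp [hb])
  cases b
  · simp [partialChar, hp, (hf p).2 hb]
  · simp [partialChar, hp, (hf p).1 hb]

theorem isExtension_partialChar {X : Type*} [LinearOrder X] {x x' : X} (hx : x' < x)
    {D E Y : Set (X × ℕ)} (hE : ∀ q ∈ E, q.1 < x' → q ∈ D) :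
    IsExtension x' (restrictF (partialChar D (restrictS Y x)) x')
      (partialChar ({q ∈ D | q.1 < x'} ∪ E) (restrictS Y x')) := by
  refine ⟨fun q b hb => ?_, fun q hq hq' => ?_⟩
  · by_cases hlt : q.1 < x'
    · by_cases hqD : q ∈ D
      · cases b <;> simpa [restrictF, restrictS, hlt, hlt.trans hx, hqD] using hb
      · simp [restrictF, partialChar, hqD] at hb
    · simp [restrictF, hlt] at hb
  · rw [partialChar_ne_none] at hq
    have hge : ¬ q.1 < x' := by
      intro hlt
      have hqD : q ∈ D := hq.elim (fun h => h.1) (fun h => hE q h hlt)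
      simp [restrictF, hlt, partialChar, hqD] at hq'
    refine ⟨not_lt.1 hge, ?_⟩
    exact partialChar_eq_false.2 ⟨hq, fun h => hge h.2⟩

section Approximations

variable {X : Type*} [LinearOrder X] {φ₀ ψ₀ : ℕ → X → (X × ℕ → Option Bool) → Prop}
  {Y : Set (X × ℕ)}

theorem Hfull.notMem_iff (hY : Hfull (phi φ₀) Y) (hprem : ETRPremise φ₀ ψ₀) (x : X) (n : ℕ) :
    (x, n) ∉ Y ↔ phi ψ₀ n x (restrictS Y x) := by
  rw [hY, hprem x _ (hY.hres x), not_not]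

theorem IsApprox.pleSet (hwf : WellFounded ((· < ·) : X → X → Prop))
    (hprem : ETRPremise φ₀ ψ₀) (hY : Hfull (phi φ₀) Y) {x : X} {f : X × ℕ → Option Bool}
    (hf : IsApprox φ₀ ψ₀ x f) : PLESet f (restrictS Y x) := by
  obtain ⟨-, hfalse, hφ, hψ⟩ := hf
  have key : ∀ x', x' < x → ∀ n, (f (x', n) = some true → (x', n) ∈ Y) ∧
      (f (x', n) = some false → (x', n) ∉ Y) := by
    intro x'
    induction x' using hwf.induction with
    | _ x' ih =>
      intro hx n
      have hres : PLESet (restrictF f x') (restrictS Y x') := by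
        rintro ⟨y, m⟩
        by_cases hy : y < x'
        · simpa [restrictF, restrictS, hy] using ih y hy (hy.trans hx) m
        · simp [restrictF, hy]
      refine ⟨fun h => ?_, fun h => ?_⟩
      · obtain ⟨g, hg, hext, hg'⟩ := hφ x' n hx h
        exact (hY x' n).2 ⟨g, hg, hext.pleSet_restrictS hres, hg'⟩
      · obtain ⟨g, hg, hext, hg'⟩ := hψ x' n hx h
        exact (hY.notMem_iff hprem x' n).2 ⟨g, hg, hext.pleSet_restrictS hres, hg'⟩
  rintro ⟨x', n⟩
  refine ⟨fun h => ?_, fun h hmem => (key x' hmem.2 n).2 h hmem.1⟩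
  have hx : x' < x := by
    by_contra hx
    exact absurd (hfalse x' n true h (not_lt.1 hx)) (by decide)
  exact ⟨(key x' hx n).1 h, hx⟩

theorem PLESet.exists_isApprox (hwf : WellFounded ((· < ·) : X → X → Prop))
    (hφmono : ∀ (n : ℕ) (x : X) (f g : X × ℕ → Option Bool),
      FinSupp f → FinSupp g → φ₀ n x f → PLE f g → φ₀ n x g)
    (hψmono : ∀ (n : ℕ) (x : X) (f g : X × ℕ → Option Bool),
      FinSupp f → FinSupp g → ψ₀ n x f → PLE f g → ψ₀ n x g)
    (hprem : ETRPremise φ₀ ψ₀) (hY : Hfull (phi φ₀) Y) {x : X} {f : X × ℕ → Option Bool}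
    (hfin : FinSupp f) (hf : PLESet f (restrictS Y x)) :
    ∃ g, IsApprox φ₀ ψ₀ x g ∧ PLE f g := by
  have hwit : ∀ p : X × ℕ, ∃ w, FinSupp w ∧ PLESet w (restrictS Y p.1) ∧
      (p ∈ Y → φ₀ p.2 p.1 w) ∧ (p ∉ Y → ψ₀ p.2 p.1 w) := by
    intro p
    by_cases hp : p ∈ Y
    · obtain ⟨w, hw, hle, hw'⟩ := (hY p.1 p.2).1 hp
      exact ⟨w, hw, hle, fun _ => hw', fun h => absurd hp h⟩
    · obtain ⟨w, hw, hle, hw'⟩ := (hY.notMem_iff hprem p.1 p.2).1 hp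
      exact ⟨w, hw, hle, fun h => absurd h hp, fun _ => hw'⟩
  choose w hwfin hwle hwφ hwψ using hwit
  obtain ⟨D, hD, hfD, hcl⟩ := exists_finite_closed_superset
    (InvImage.wf (Prod.fst : X × ℕ → X) hwf) (S := fun p => {q | w p q ≠ none ∧ q.1 < p.1})
    (fun p => (hwfin p).subset fun q hq => hq.1) (fun p q hq => hq.2) hfin
  have hext (x' : X) (n : ℕ) (hx : x' < x) (hmem : (x', n) ∈ D) :
      ∃ h, FinSupp h ∧ IsExtension x' (restrictF (partialChar D (restrictS Y x)) x') h ∧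
        PLE (w (x', n)) h :=
    ⟨_, finSupp_partialChar ((hD.subset (Set.sep_subset _ _)).union (hwfin (x', n))) _,
      isExtension_partialChar hx fun q hq hlt => hcl _ hmem ⟨hq, hlt⟩,
      (hwle (x', n)).ple_partialChar fun q hq => Or.inr hq⟩
  refine ⟨partialChar D (restrictS Y x), ⟨finSupp_partialChar hD _, fun x' n b hb hx => ?_,
    fun x' n hx hb => ?_, fun x' n hx hb => ?_⟩, hf.ple_partialChar hfD⟩
  · cases b
    · rfl
    · exact absurd (partialChar_eq_true.1 hb).2.2 hx.not_gt
  · have hmem := (partialChar_eq_true.1 hb).1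
    obtain ⟨h, hh, hhext, hle⟩ := hext x' n hx hmem
    have hp : (x', n) ∈ Y := (partialChar_eq_true.1 hb).2.1
    exact ⟨h, hh, hhext, hφmono _ _ _ _ (hwfin _) hh (hwφ _ hp) hle⟩
  · have hmem := (partialChar_eq_false.1 hb).1
    obtain ⟨h, hh, hhext, hle⟩ := hext x' n hx hmem
    have hp : (x', n) ∉ Y := fun h => (partialChar_eq_false.1 hb).2 ⟨h, hx⟩
    exact ⟨h, hh, hhext, hψmono _ _ _ _ (hwfin _) hh (hwψ _ hp) hle⟩

end Approximations

/-- under the ETR premise, the set of pairs `(x,n)` with `φ₀(n,x,f)` for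
some `x`-approximation `f` equals the set of pairs with `ψ₀(n,x,g)` for no
`x`-approximation `g`. -/
theorem stmt_7 {X : Type*} [LinearOrder X]
    (hwf : WellFounded ((· < ·) : X → X → Prop))
    (φ₀ ψ₀ : ℕ → X → (X × ℕ → Option Bool) → Prop)
    (hφmono : ∀ (n : ℕ) (x : X) (f g : X × ℕ → Option Bool),
      FinSupp f → FinSupp g → φ₀ n x f → PLE f g → φ₀ n x g)
    (hψmono : ∀ (n : ℕ) (x : X) (f g : X × ℕ → Option Bool),
      FinSupp f → FinSupp g → ψ₀ n x f → PLE f g → ψ₀ n x g)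
    (hprem : ETRPremise φ₀ ψ₀) :
    {p : X × ℕ | ∃ f, IsApprox φ₀ ψ₀ p.1 f ∧ φ₀ p.2 p.1 f} =
      {p : X × ℕ | ¬ ∃ g, IsApprox φ₀ ψ₀ p.1 g ∧ ψ₀ p.2 p.1 g} := by
  obtain ⟨Y, hY⟩ := exists_Hfull hwf (phi φ₀)
  ext ⟨x, n⟩
  have hφ : (∃ f, IsApprox φ₀ ψ₀ x f ∧ φ₀ n x f) ↔ (x, n) ∈ Y := by
    rw [hY]
    refine ⟨fun ⟨f, hf, hf'⟩ => ⟨f, hf.1, hf.pleSet hwf hprem hY, hf'⟩, ?_⟩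
    rintro ⟨f, hfin, hf, hf'⟩
    obtain ⟨g, hg, hle⟩ := hf.exists_isApprox hwf hφmono hψmono hprem hY hfin
    exact ⟨g, hg, hφmono n x f g hfin hg.1 hf' hle⟩
  have hψ : (∃ g, IsApprox φ₀ ψ₀ x g ∧ ψ₀ n x g) ↔ (x, n) ∉ Y := by
    rw [hY.notMem_iff hprem]
    refine ⟨fun ⟨f, hf, hf'⟩ => ⟨f, hf.1, hf.pleSet hwf hprem hY, hf'⟩, ?_⟩
    rintro ⟨f, hfin, hf, hf'⟩
    obtain ⟨g, hg, hle⟩ := hf.exists_isApprox hwf hφmono hψmono hprem hY hfin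
    exact ⟨g, hg, hψmono n x f g hfin hg.1 hf' hle⟩
  simp only [Set.mem_ofPred_eq, hφ, hψ, not_not]
end
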